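/- The Hausdorff dimension of the graph of f is equal to 1: dimH {(x, f(x)) : x ∈ [0,1)} = 1, where the graph is regarded as a subset of ℝ × ℝ (equivalently ℝ²). -/

import Mathlib

/-- The `n`-th ternary digit of `x` (n = 0,1,2,...). -/
noncomputable def terDigit (n : ℕ) (x : ℝ) : ℤ := ⌊(3:ℝ)^(n+1) * x⌋ % 3

/-- φ(i) = (−3i² + 7i)/2, so φ(0)=0, φ(1)=2, φ(2)=1. -/
noncomputable def phi (i : ℤ) : ℝ := (-3*(i:ℝ)^2 + 7*(i:ℝ))/2

/-- φ01(i) = (i² − i)/2. -/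
noncomputable def phi01 (i : ℤ) : ℝ := ((i:ℝ)^2 - (i:ℝ))/2

/-- φ02(i) = −i² + 2i. -/
noncomputable def phi02 (i : ℤ) : ℝ := -(i:ℝ)^2 + 2*(i:ℝ)

/-- φ12(i) = (i² − 3i + 2)/2. -/
noncomputable def phi12 (i : ℤ) : ℝ := ((i:ℝ)^2 - 3*(i:ℝ) + 2)/2

/-- f(x) = ∑ φ(d_n(x))/3^(n+1). -/
noncomputable def f (x : ℝ) : ℝ := ∑' n : ℕ, phi (terDigit n x) / 3^(n+1)

noncomputable def f01 (x : ℝ) : ℝ := ∑' n : ℕ, phi01 (terDigit n x) / 3^(n+1)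

noncomputable def f02 (x : ℝ) : ℝ := ∑' n : ℕ, phi02 (terDigit n x) / 3^(n+1)

noncomputable def f12 (x : ℝ) : ℝ := ∑' n : ℕ, phi12 (terDigit n x) / 3^(n+1)

/-- `x` is ternary-irrational: `3^n x` is never an integer. -/
def TernaryIrrational (x : ℝ) : Prop := ∀ n : ℕ, ¬ ∃ k : ℤ, (3:ℝ)^n * x = (k:ℝ)

theorem terDigit_eq_of_floor_eq {n m : ℕ} (hm : m < n) {x y : ℝ}
    (h : ⌊(3:ℝ) ^ n * x⌋ = ⌊(3:ℝ) ^ n * y⌋) : terDigit m x = terDigit m y := by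
  have key : ∀ z : ℝ, ⌊(3:ℝ) ^ (m + 1) * z⌋ = ⌊(3:ℝ) ^ n * z⌋ / ((3 ^ (n - (m + 1)) : ℕ) : ℤ) := by
    intro z
    rw [← Int.floor_div_natCast]
    congr 1
    have h3 : (3:ℝ) ^ n = 3 ^ (m + 1) * 3 ^ (n - (m + 1)) := by
      rw [← pow_add]; congr 1; omega
    rw [h3]
    push_cast
    field_simp
  unfold terDigit
  rw [key x, key y, h]

theorem phi_terDigit_mem_Icc (n : ℕ) (x : ℝ) : phi (terDigit n x) ∈ Set.Icc (0:ℝ) 2 := by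
  have h : terDigit n x = 0 ∨ terDigit n x = 1 ∨ terDigit n x = 2 := by
    unfold terDigit; omega
  rcases h with h | h | h <;> rw [h] <;> norm_num [phi]

theorem hasSum_two_div_three_pow (n : ℕ) :
    HasSum (fun m : ℕ => (2:ℝ) / 3 ^ (m + n + 1)) ((3 ^ n)⁻¹) := by
  have h := (hasSum_geometric_of_lt_one (r := (1 / 3 : ℝ)) (by norm_num) (by norm_num)).mul_left
    ((2:ℝ) / 3 ^ (n + 1))
  convert! h using 1
  · ext m
    rw [one_div_pow, pow_succ, pow_add, pow_succ]
    field_simp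
  · rw [pow_succ]
    field_simp
    norm_num

theorem summable_phi_terDigit (x : ℝ) :
    Summable fun n : ℕ => phi (terDigit n x) / (3:ℝ) ^ (n + 1) :=
  (hasSum_two_div_three_pow 0).summable.of_nonneg_of_le
    (fun n => div_nonneg (phi_terDigit_mem_Icc n x).1 (by positivity))
    (fun n => div_le_div_of_nonneg_right (phi_terDigit_mem_Icc n x).2 (by positivity))

theorem abs_f_sub_le_of_floor_eq {n : ℕ} {x y : ℝ}
    (h : ⌊(3:ℝ) ^ n * x⌋ = ⌊(3:ℝ) ^ n * y⌋) : |f x - f y| ≤ (3 ^ n)⁻¹ := by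
  have head : ∑ m ∈ Finset.range n, phi (terDigit m x) / (3:ℝ) ^ (m + 1) =
      ∑ m ∈ Finset.range n, phi (terDigit m y) / (3:ℝ) ^ (m + 1) :=
    Finset.sum_congr rfl fun m hm => by
      rw [terDigit_eq_of_floor_eq (Finset.mem_range.1 hm) h]
  have tail : ∀ z : ℝ, ∑' m : ℕ, phi (terDigit (m + n) z) / (3:ℝ) ^ (m + n + 1) ∈
      Set.Icc (0:ℝ) ((3 ^ n)⁻¹) := fun z =>
    ⟨tsum_nonneg fun m => div_nonneg (phi_terDigit_mem_Icc _ z).1 (by positivity),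
      hasSum_le (fun m => div_le_div_of_nonneg_right (phi_terDigit_mem_Icc _ z).2 (by positivity))
        ((summable_nat_add_iff n).2 (summable_phi_terDigit z)).hasSum
        (hasSum_two_div_three_pow n)⟩
  have hx := (summable_phi_terDigit x).sum_add_tsum_nat_add n
  have hy := (summable_phi_terDigit y).sum_add_tsum_nat_add n
  obtain ⟨hx0, hx1⟩ := tail x
  obtain ⟨hy0, hy1⟩ := tail y
  unfold f
  rw [← hx, ← hy, head, add_sub_add_left_eq_sub, abs_le]
  constructor <;> linarith

theorem abs_sub_le_of_floor_eq {n : ℕ} {x y : ℝ}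
    (h : ⌊(3:ℝ) ^ n * x⌋ = ⌊(3:ℝ) ^ n * y⌋) : |x - y| ≤ (3 ^ n)⁻¹ := by
  have h1 := Int.abs_sub_lt_one_of_floor_eq_floor h
  rw [← mul_sub, abs_mul, abs_of_pos (by positivity)] at h1
  rw [inv_eq_one_div, le_div_iff₀' (by positivity)]
  exact h1.le

theorem hausdorffMeasure_graph_f_le_one :
    MeasureTheory.Measure.hausdorffMeasure 1 ((fun x : ℝ => (x, f x)) '' Set.Ico (0:ℝ) 1) ≤ 1 := by
  let r : ℕ → ENNReal := fun n => ENNReal.ofReal ((3 ^ n)⁻¹)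
  let t : (n : ℕ) → Fin (3 ^ n) → Set (ℝ × ℝ) := fun n k =>
    (fun x : ℝ => (x, f x)) '' {x | ⌊(3:ℝ) ^ n * x⌋ = (k : ℕ)}
  have hr : Filter.Tendsto r Filter.atTop (nhds 0) := by
    have h := tendsto_pow_atTop_nhds_zero_of_lt_one (r := (3⁻¹ : ℝ)) (by norm_num) (by norm_num)
    simpa [r] using ENNReal.tendsto_ofReal h
  have hdiam : ∀ n k, Metric.ediam (t n k) ≤ r n := by
    intro n k
    refine Metric.ediam_le ?_
    rintro _ ⟨x, hx, rfl⟩ _ ⟨y, hy, rfl⟩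
    have hxy : ⌊(3:ℝ) ^ n * x⌋ = ⌊(3:ℝ) ^ n * y⌋ := hx.trans hy.symm
    rw [edist_dist]
    refine ENNReal.ofReal_le_ofReal ?_
    rw [Prod.dist_eq, Real.dist_eq, Real.dist_eq]
    exact max_le (abs_sub_le_of_floor_eq hxy) (abs_f_sub_le_of_floor_eq hxy)
  refine (MeasureTheory.Measure.hausdorffMeasure_le_liminf_sum 1 _ r hr t
    (.of_forall hdiam) (.of_forall fun n => ?_)).trans ?_
  · rintro _ ⟨x, ⟨hx0, hx1⟩, rfl⟩
    have h0 : 0 ≤ ⌊(3:ℝ) ^ n * x⌋ := Int.floor_nonneg.2 (by positivity)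
    have h1 : ⌊(3:ℝ) ^ n * x⌋ < (3 ^ n : ℕ) := by
      rw [Int.floor_lt]
      push_cast
      exact mul_lt_of_lt_one_right (by positivity) hx1
    exact Set.mem_iUnion.2 ⟨⟨⌊(3:ℝ) ^ n * x⌋.toNat, by omega⟩, x,
      (Int.toNat_of_nonneg h0).symm, rfl⟩
  · refine Filter.liminf_le_of_le (by isBoundedDefault) fun b hb => ?_
    obtain ⟨n, hn⟩ := hb.exists
    refine hn.trans ?_
    calc ∑ k, Metric.ediam (t n k) ^ (1:ℝ) ≤ ∑ _k : Fin (3 ^ n), r n :=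
          Finset.sum_le_sum fun k _ => by simpa using hdiam n k
      _ = ENNReal.ofReal (3 ^ n * (3 ^ n)⁻¹) := by
          rw [ENNReal.ofReal_mul (by positivity)]
          simp [r, ENNReal.ofReal_pow]
      _ = 1 := by rw [mul_inv_cancel₀ (by positivity), ENNReal.ofReal_one]

theorem stmt_18 : dimH ((fun x : ℝ => (x, f x)) '' Set.Ico (0:ℝ) 1) = 1 := by
  apply le_antisymm
  · exact dimH_le_of_hausdorffMeasure_ne_top (d := 1)
      (ne_top_of_le_ne_top ENNReal.one_ne_top hausdorffMeasure_graph_f_le_one)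
  · have h := LipschitzWith.prod_fst.dimH_image_le
      ((fun x : ℝ => (x, f x)) '' Set.Ico (0:ℝ) 1)
    have hI : dimH (Set.Ico (0:ℝ) 1) = 1 := by
      rw [Real.dimH_of_nonempty_interior (by simp)]
      simp
    rwa [Set.image_image, Set.image_id', hI] at h
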